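/- Let S be a numerical semigroup admitting a monic pattern p of admissibility degree 2, written in standard decomposition as p(x₁,…,xₙ) = x₁ + C_p(x₂,…,x_t) + T_p(x_{t+1},…,xₙ), and let E be a semigroup ideal of S. Then S ⋈ᵈ E admits p eventually with respect to d if and only if: (1) for every i ∈ {1,…,t}, if bᵢ is odd then (bᵢ−1)/2 ∈ E−E, and if bᵢ is even then bᵢ/2 ≥ c(E) − min(E); and (2) S ⋈ᵈ E admits the pattern x₁ + T_p eventually with respect to d. -/

import Mathlib

/-- A numerical semigroup: an additive submonoid of ℕ with finite complement. -/
def IsNumericalSemigroup (S : Set ℕ) : Prop :=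
  0 ∈ S ∧ (∀ a ∈ S, ∀ b ∈ S, a + b ∈ S) ∧ Sᶜ.Finite

/-- Evaluation of a pattern (list of coefficients a₁,…,aₙ) at s₁,…,sₙ. -/
def patEval (p : List ℤ) (s : ℕ → ℕ) : ℤ :=
  ∑ i ∈ Finset.range p.length, p.getD i 0 * (s i : ℤ)

/-- `S` admits the pattern `p`: p(s₁,…,sₙ) ∈ S for all s₁ ≥ ⋯ ≥ sₙ in S. -/
def AdmitsPat (S : Set ℕ) (p : List ℤ) : Prop :=
  ∀ s : ℕ → ℕ, (∀ i, s i ∈ S) → (∀ i j, i ≤ j → s j ≤ s i) →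
    ∃ m ∈ S, (m : ℤ) = patEval p s

/-- A pattern is admissible if it is admitted by some numerical semigroup. -/
def Admissible (p : List ℤ) : Prop :=
  ∃ S : Set ℕ, IsNumericalSemigroup S ∧ AdmitsPat S p

/-- The derivative p' of a pattern. -/
def pderiv : List ℤ → List ℤ
  | [] => []
  | a :: q => if a = 1 then q else (a - 1) :: q

/-- The admissibility degree: least k such that p⁽ᵏ⁾ is not admissible, or ∞. -/
noncomputable def adDeg (p : List ℤ) : ℕ∞ :=
  sInf ((fun m : ℕ => (m : ℕ∞)) '' {m : ℕ | ¬ Admissible (pderiv^[m] p)})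

/-- The partial sum bᵢ = a₁ + ⋯ + aᵢ of the coefficients of `p`. -/
def psum (p : List ℤ) (i : ℕ) : ℤ :=
  ∑ j ∈ Finset.range i, p.getD j 0

/-- The numerical duplication S ⋈ᵈ E = 2·S ∪ (2·E + d). -/
def numDup (S E : Set ℕ) (d : ℕ) : Set ℕ :=
  {x | ∃ s ∈ S, x = 2 * s} ∪ {x | ∃ e ∈ E, x = 2 * e + d}

/-- S ⋈ᵈ E admits p eventually with respect to d. -/
def EventuallyAdmits (S E : Set ℕ) (p : List ℤ) : Prop :=
  ∃ d' : ℕ, ∀ d : ℕ, d ∈ S → Odd d → d' ≤ d → AdmitsPat (numDup S E d) p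

/-- The relative ideal E − E = {z ∈ ℤ : z + E ⊆ E}. -/
def EmE (E : Set ℕ) : Set ℤ :=
  {z : ℤ | ∀ e ∈ E, ∃ f ∈ E, (f : ℤ) = z + (e : ℤ)}

/-- The conductor c(E) = min{x ∈ ℕ : x + ℕ ⊆ E}. -/
noncomputable def condOf (E : Set ℕ) : ℕ :=
  sInf {c : ℕ | ∀ x : ℕ, c ≤ x → x ∈ E}

theorem patEval_cons (a : ℤ) (q : List ℤ) (s : ℕ → ℕ) :
    patEval (a :: q) s = a * (s 0 : ℤ) + patEval q (fun i => s (i + 1)) := by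
  unfold patEval
  rw [List.length_cons, Finset.sum_range_succ']
  simp [add_comm]

theorem patEval_append (q r : List ℤ) (s : ℕ → ℕ) :
    patEval (q ++ r) s = patEval q s + patEval r (fun i => s (i + q.length)) := by
  induction q generalizing s with
  | nil => simp [patEval]
  | cons a q ih =>
    rw [List.cons_append, patEval_cons, patEval_cons, ih]
    simp only [List.length_cons, add_assoc]

theorem psum_cons (a : ℤ) (q : List ℤ) (i : ℕ) :
    psum (a :: q) (i + 1) = a + psum q i := by
  unfold psum
  rw [Finset.sum_range_succ']
  simp [add_comm]

theorem psum_append (q r : List ℤ) (i : ℕ) (hi : i ≤ q.length) :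
    psum (q ++ r) i = psum q i := by
  unfold psum
  apply Finset.sum_congr rfl
  intro j hj
  rw [List.getD_append]
  have := Finset.mem_range.1 hj
  omega

theorem psum_length (q : List ℤ) : psum q q.length = q.sum := by
  induction q with
  | nil => simp [psum]
  | cons a q ih => rw [List.length_cons, psum_cons, ih, List.sum_cons]

theorem abel_aux (c : ℕ → ℤ) (s : ℕ → ℤ) (n : ℕ) :
    ∑ i ∈ Finset.range n, c i * s i =
      ∑ i ∈ Finset.range n, (∑ j ∈ Finset.range (i + 1), c j) * (s i - s (i + 1))
        + (∑ j ∈ Finset.range n, c j) * s n := by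
  induction n with
  | zero => simp
  | succ n ih =>
    rw [Finset.sum_range_succ, ih, Finset.sum_range_succ (fun i => _ * (s i - s (i + 1))),
      Finset.sum_range_succ c]
    ring

theorem abel (q : List ℤ) (s : ℕ → ℕ) :
    patEval q s = ∑ i ∈ Finset.range q.length, psum q (i + 1) * ((s i : ℤ) - s (i + 1))
        + psum q q.length * s q.length :=
  abel_aux (fun i => q.getD i 0) (fun i => (s i : ℤ)) q.length

theorem exists_bound {S : Set ℕ} (h : Sᶜ.Finite) : ∃ N, ∀ x, N ≤ x → x ∈ S := by
  obtain ⟨N, hN⟩ := h.bddAbove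
  refine ⟨N + 1, fun x hx => ?_⟩
  by_contra hc
  have := hN hc
  omega

theorem psum_nonneg {q : List ℤ} (h : Admissible q) (i : ℕ) (hi : i ≤ q.length) :
    0 ≤ psum q i := by
  obtain ⟨S, ⟨h0, -, hfin⟩, hS⟩ := h
  obtain ⟨N, hN⟩ := exists_bound hfin
  obtain ⟨m, -, hm⟩ := hS (fun k => if k < i then N + 1 else 0)
    (fun k => by
      try dsimp only
      split_ifs
      · exact hN _ (by omega)
      · exact h0)
    (fun a b hab => by
      try dsimp only
      split_ifs <;> omega)
  have e : patEval q (fun k => if k < i then N + 1 else 0) = psum q i * (N + 1) := by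
    unfold patEval psum
    rw [Finset.sum_mul, ← Finset.sum_subset (Finset.range_subset_range.2 hi)]
    · apply Finset.sum_congr rfl
      intro k hk
      simp [Finset.mem_range.1 hk]
    · intro k _ hk
      rw [Finset.mem_range] at hk
      simp [hk]
  rw [e] at hm
  have : (0 : ℤ) ≤ psum q i * (N + 1) := by omega
  exact nonneg_of_mul_nonneg_left this (by positivity)

theorem tail_eval {T : List ℤ} (hT : 1 < adDeg T) (hnz : ∀ a ∈ T, a ≠ 0) (s : ℕ → ℕ)
    (hs : ∀ i j, i ≤ j → s j ≤ s i) :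
    T = [] ∨ (s 0 : ℤ) ≤ patEval T s := by
  have key : ∀ m : ℕ, m ≤ 1 → Admissible (pderiv^[m] T) := by
    intro m hm
    by_contra hc
    have : adDeg T ≤ m := sInf_le ⟨m, hc, rfl⟩
    have h2 : ((1 : ℕ) : ℕ∞) < (m : ℕ∞) := lt_of_lt_of_le (by simpa using hT) this
    rw [Nat.cast_lt] at h2
    omega
  have h0 := key 0 (by omega)
  have h1 := key 1 (by omega)
  simp only [Function.iterate_zero, id, Function.iterate_one] at h0 h1
  cases T with
  | nil => left; rfl
  | cons a q =>
    right
    have hb : ∀ i ≤ q.length, 0 ≤ a - 1 + psum q i := by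
      intro i hi
      have ha := psum_nonneg h0 1 (by simp)
      have ha' := hnz a (by simp)
      rw [show (1 : ℕ) = 0 + 1 from rfl, psum_cons] at ha
      have hz : psum q 0 = 0 := by simp [psum]
      rw [hz] at ha
      simp only [pderiv] at h1
      split_ifs at h1 with h
      · have := psum_nonneg h1 i hi
        omega
      · have := psum_nonneg h1 (i + 1) (by simpa using hi)
        rwa [psum_cons] at this
    have hab := abel ((a - 1) :: q) s
    have e1 : patEval (a :: q) s = s 0 + patEval ((a - 1) :: q) s := by
      rw [patEval_cons, patEval_cons]; ring
    rw [e1, hab]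
    have t1 : 0 ≤ ∑ i ∈ Finset.range ((a - 1) :: q).length,
        psum ((a - 1) :: q) (i + 1) * ((s i : ℤ) - s (i + 1)) := by
      apply Finset.sum_nonneg
      intro i hi
      rw [Finset.mem_range, List.length_cons] at hi
      have := hs i (i + 1) (by omega)
      rw [psum_cons]
      exact mul_nonneg (hb i (by omega)) (by omega)
    have t2 : 0 ≤ psum ((a - 1) :: q) ((a - 1) :: q).length * (s ((a - 1) :: q).length : ℤ) := by
      rw [List.length_cons, psum_cons]
      exact mul_nonneg (hb _ le_rfl) (by positivity)
    linarith

theorem EmE_zero (E : Set ℕ) : (0 : ℤ) ∈ EmE E := fun e he => ⟨e, he, by simp⟩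

theorem EmE_add {E : Set ℕ} {a b : ℤ} (ha : a ∈ EmE E) (hb : b ∈ EmE E) : a + b ∈ EmE E := by
  intro e he
  obtain ⟨f, hf, h1⟩ := hb e he
  obtain ⟨g, hg, h2⟩ := ha f hf
  exact ⟨g, hg, by rw [h2, h1]; ring⟩

theorem EmE_mul {E : Set ℕ} {a : ℤ} (ha : a ∈ EmE E) (n : ℕ) : a * n ∈ EmE E := by
  induction n with
  | zero => simpa using EmE_zero E
  | succ n ih =>
    have := EmE_add ih ha
    push_cast
    rwa [mul_add, mul_one]

theorem even_patEval (q : List ℤ) (s : ℕ → ℕ) (h : ∀ i, Even (s i)) : Even (patEval q s) := by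
  unfold patEval
  apply Finset.even_sum
  intro i _
  exact Even.mul_left (by exact_mod_cast h i) _

theorem step_eval (C T : List ℤ) (hC : C.sum = 0) (X x y j : ℕ) (hj : j < C.length)
    (h1 : x ≤ X) (h2 : y ≤ x) (D : Set ℕ) (h0 : 0 ∈ D) (hX : X ∈ D) (hx : x ∈ D) (hy : y ∈ D)
    (h : AdmitsPat D (1 :: (C ++ T))) :
    ∃ m ∈ D, (m : ℤ) = X + psum C (j + 1) * ((x : ℤ) - y) := by
  set s : ℕ → ℕ := fun k => if k = 0 then X else if k ≤ j + 1 then x else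
    if k ≤ C.length then y else 0 with hs
  obtain ⟨m, hm, he⟩ := h s
    (fun k => by
      simp only [hs]
      split_ifs <;> assumption)
    (fun a b hab => by
      simp only [hs]
      split_ifs <;> omega)
  refine ⟨m, hm, ?_⟩
  rw [he, patEval_cons, patEval_append]
  have eT : patEval T (fun i => s (i + C.length + 1)) = 0 := by
    unfold patEval
    apply Finset.sum_eq_zero
    intro i _
    have : s (i + C.length + 1) = 0 := by
      simp only [hs]
      rw [if_neg (by omega), if_neg (by omega), if_neg (by omega)]
    simp [this]
  have eC : patEval C (fun i => s (i + 1)) = psum C (j + 1) * ((x : ℤ) - y) := by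
    have e : patEval C (fun i => s (i + 1)) =
        ∑ i ∈ Finset.range C.length, (C.getD i 0 * (y : ℤ) +
          if i < j + 1 then C.getD i 0 * ((x : ℤ) - y) else 0) := by
      unfold patEval
      apply Finset.sum_congr rfl
      intro i hi
      rw [Finset.mem_range] at hi
      simp only [hs]
      rw [if_neg (by omega)]
      by_cases hij : i < j + 1
      · rw [if_pos (by omega), if_pos hij]; ring
      · rw [if_neg (by omega), if_pos (by omega), if_neg hij]; ring
    rw [e, Finset.sum_add_distrib, ← Finset.sum_mul]
    have z : ∑ i ∈ Finset.range C.length, C.getD i 0 = 0 := by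
      have := psum_length C
      rw [hC] at this
      exact this
    rw [z, zero_mul, zero_add]
    unfold psum
    rw [Finset.sum_mul, ← Finset.sum_subset (Finset.range_subset_range.2 (show j + 1 ≤ C.length from hj))]
    · apply Finset.sum_congr rfl
      intro k hk
      rw [if_pos (Finset.mem_range.1 hk)]
    · intro k _ hk
      rw [Finset.mem_range] at hk
      rw [if_neg hk]
  have eC' := eC
  rw [eT, eC]
  simp [hs]

theorem mem_numDup_even {S E : Set ℕ} {d r : ℕ} (h : r ∈ S) : 2 * r ∈ numDup S E d :=
  Or.inl ⟨r, h, rfl⟩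

theorem mem_numDup_odd {S E : Set ℕ} {d r : ℕ} (h : r ∈ E) : 2 * r + d ∈ numDup S E d :=
  Or.inr ⟨r, h, rfl⟩

theorem of_odd_mem {S E : Set ℕ} {d m : ℕ} (h : m ∈ numDup S E d) (hm : Odd m) :
    ∃ e ∈ E, m = 2 * e + d := by
  rcases h with ⟨s, -, rfl⟩ | h
  · obtain ⟨k, hk⟩ := hm
    omega
  · exact h

theorem of_even_mem {S E : Set ℕ} {d m : ℕ} (h : m ∈ numDup S E d) (hd : Odd d) (hm : Even m) :
    ∃ r ∈ S, m = 2 * r := by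
  rcases h with h | ⟨e, -, rfl⟩
  · exact h
  · obtain ⟨k, hk⟩ := hm
    obtain ⟨l, hl⟩ := hd
    omega

/-- Let p be a monic pattern of admissibility degree 2 admitted by S, with
standard decomposition p(x₁,…,xₙ) = x₁ + C_p(x₂,…,x_t) + T_p(x_{t+1},…,xₙ)
(so t = C.length + 1). Then S ⋈ᵈ E admits p eventually with respect to d iff
(1) for every i ∈ {1,…,t}: if bᵢ is odd then (bᵢ−1)/2 ∈ E − E, and if bᵢ is
even then bᵢ/2 ≥ c(E) − min(E); and (2) S ⋈ᵈ E admits x₁ + T_p eventually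
with respect to d. -/
theorem stmt_17 (S E : Set ℕ) (hS : IsNumericalSemigroup S)
    (hES : E ⊆ S) (hE : ∀ e ∈ E, ∀ s ∈ S, e + s ∈ E) (hEne : E.Nonempty)
    (C T p : List ℤ) (hpCT : p = 1 :: (C ++ T))
    (hp : ∀ a ∈ p, a ≠ 0) (hdeg : adDeg p = 2)
    (hCadm : Admissible C) (hCsum : C.sum = 0) (hTdeg : 1 < adDeg T)
    (hSp : AdmitsPat S p) :
    EventuallyAdmits S E p ↔
      ((∀ i : ℕ, 1 ≤ i → i ≤ C.length + 1 →
          (Odd (psum p i) → (psum p i - 1) / 2 ∈ EmE E) ∧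
          (Even (psum p i) →
            (condOf E : ℤ) - ((sInf E : ℕ) : ℤ) ≤ psum p i / 2)) ∧
        EventuallyAdmits S E (1 :: T)) := by
  subst hpCT
  obtain ⟨h0, hadd, hfin⟩ := hS
  obtain ⟨N, hN⟩ := exists_bound hfin
  have hEm : sInf E ∈ E := Nat.sInf_mem hEne
  have hcond : ∀ x, condOf E ≤ x → x ∈ E := by
    have : condOf E ∈ {c : ℕ | ∀ x : ℕ, c ≤ x → x ∈ E} := by
      apply Nat.sInf_mem
      refine ⟨sInf E + N, fun x hx => ?_⟩
      have := hE _ hEm (x - sInf E) (hN _ (by omega))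
      rwa [Nat.add_sub_cancel' (by omega)] at this
    exact this
  have hps : ∀ j, j < C.length → psum (1 :: (C ++ T)) (j + 1 + 1) = 1 + psum C (j + 1) := by
    intro j hj
    rw [psum_cons, psum_append _ _ _ (by omega)]
  have hps0 : psum (1 :: (C ++ T)) 1 = 1 := by
    rw [show (1 : ℕ) = 0 + 1 from rfl, psum_cons]; simp [psum]
  have hBL : psum C C.length = 0 := by rw [psum_length, hCsum]
  constructor
  · rintro ⟨d', hd'⟩
    refine ⟨?_, d', ?_⟩
    · intro i hi1 hi2
      obtain ⟨d, hdS, ⟨q, hq⟩, hdd, hqN⟩ : ∃ d, d ∈ S ∧ Odd d ∧ d' ≤ d ∧ 2 * N ≤ d :=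
        ⟨2 * (N + d') + 1, hN _ (by omega), ⟨_, rfl⟩, by omega, by omega⟩
      have hD := hd' d hdS ⟨q, hq⟩ hdd
      have hD0 : 0 ∈ numDup S E d := mem_numDup_even (r := 0) h0
      obtain rfl | ⟨j, rfl⟩ : i = 1 ∨ ∃ j, i = j + 1 + 1 := by
        rcases i with _ | _ | j
        · omega
        · left; rfl
        · right; exact ⟨j, rfl⟩
      · rw [hps0]
        exact ⟨fun _ => by simpa using EmE_zero E, fun h => absurd h (by decide)⟩
      have hj : j < C.length := by omega
      rw [hps j hj]
      set B := psum C (j + 1) with hB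
      constructor
      · rintro ⟨b, hb⟩ e he
        have hx : 2 * e + d ∈ numDup S E d := mem_numDup_odd he
        have hy : 2 * (e + q) ∈ numDup S E d := mem_numDup_even (hN _ (by omega))
        obtain ⟨m, hm, hme⟩ := step_eval C T hCsum (2 * e + d) (2 * e + d) (2 * (e + q)) j hj
          le_rfl (by omega) _ hD0 hx hx hy hD
        have e1 : (((2 * e + d : ℕ) : ℤ) - ((2 * (e + q) : ℕ) : ℤ)) = 1 := by
          rw [hq]; push_cast; ring
        rw [e1, ← hB, mul_one] at hme
        obtain ⟨f, hf, rfl⟩ := of_odd_mem hm (by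
          rw [Nat.odd_iff]; omega)
        exact ⟨f, hf, by omega⟩
      · rintro ⟨b, hb⟩
        have hBn : 0 ≤ B := psum_nonneg hCadm (j + 1) (by omega)
        have hle : condOf E ≤ sInf E + b.toNat := by
          apply Nat.sInf_le
          intro z hz
          obtain ⟨k, rfl⟩ := Nat.exists_eq_add_of_le hz
          have hy : 2 * sInf E + d ∈ numDup S E d := mem_numDup_odd hEm
          have hx : 2 * (sInf E + q + 1) ∈ numDup S E d := mem_numDup_even (hN _ (by omega))
          have hX : 2 * (sInf E + q + 1 + k) ∈ numDup S E d := mem_numDup_even (hN _ (by omega))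
          obtain ⟨m, hm, hme⟩ := step_eval C T hCsum _ _ _ j hj
            (by omega) (by omega) _ hD0 hX hx hy hD
          have e1 : (((2 * (sInf E + q + 1) : ℕ) : ℤ) - ((2 * sInf E + d : ℕ) : ℤ)) = 1 := by
            rw [hq]; push_cast; ring
          rw [e1, ← hB, mul_one] at hme
          obtain ⟨f, hf, rfl⟩ := of_odd_mem hm (by
            rw [Nat.odd_iff]; omega)
          have : sInf E + b.toNat + k = f := by omega
          rw [this]; exact hf
        omega
    · intro d hdS hdo hdd s hs hmono
      set s' : ℕ → ℕ := fun k => if k ≤ C.length then s 0 else s (k - C.length) with hs'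
      obtain ⟨m, hm, hme⟩ := hd' d hdS hdo hdd s'
        (fun k => by
          simp only [hs']
          split_ifs <;> apply hs)
        (fun a b hab => by
          simp only [hs']
          split_ifs
          · exact le_rfl
          · omega
          · exact hmono _ _ (by omega)
          · exact hmono _ _ (by omega))
      refine ⟨m, hm, ?_⟩
      rw [hme, patEval_cons, patEval_cons, patEval_append]
      have eC : patEval C (fun i => s' (i + 1)) = 0 := by
        have : patEval C (fun i => s' (i + 1)) =
            ∑ i ∈ Finset.range C.length, C.getD i 0 * (s 0 : ℤ) := by
          unfold patEval
          apply Finset.sum_congr rfl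
          intro i hi
          rw [Finset.mem_range] at hi
          simp only [hs']
          rw [if_pos (by omega)]
        rw [this, ← Finset.sum_mul]
        have z : ∑ i ∈ Finset.range C.length, C.getD i 0 = 0 := hBL
        rw [z, zero_mul]
      have eT : (fun i => s' (i + C.length + 1)) = fun i => s (i + 1) := by
        funext i
        simp only [hs']
        rw [if_neg (by omega)]
        congr 1
        omega
      have e0 : s' 0 = s 0 := by simp [hs']
      rw [eC, eT, e0]; ring
  · rintro ⟨hcd, d', hd'⟩
    refine ⟨d' + 2 * condOf E + 1, ?_⟩
    intro d hdS hdo hdd s hs hmono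
    by_cases hall : ∀ i, Even (s i)
    · have hr : ∀ i, ∃ r ∈ S, s i = 2 * r := fun i => of_even_mem (hs i) hdo (hall i)
      choose r hrS hr using hr
      obtain ⟨m, hm, hme⟩ := hSp r hrS (fun i j hij => by
        have := hmono i j hij
        rw [hr, hr] at this
        omega)
      refine ⟨2 * m, mem_numDup_even hm, ?_⟩
      push_cast
      rw [hme]
      unfold patEval
      rw [Finset.mul_sum]
      apply Finset.sum_congr rfl
      intro i _
      rw [hr]; push_cast; ring
    have hs0 : 2 * sInf E + d ≤ s 0 := by
      push Not at hall
      obtain ⟨i, hi⟩ := hall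
      rw [Nat.not_even_iff_odd] at hi
      obtain ⟨e, he, h⟩ := of_odd_mem (hs i) hi
      have h1 := hmono 0 i (by omega)
      have h2 : sInf E ≤ e := Nat.sInf_le he
      omega
    obtain ⟨v, hv, hve⟩ := hd' d hdS hdo (by omega)
      (fun k => if k = 0 then s 0 else s (k + C.length))
      (fun k => by
        try dsimp only
        split_ifs <;> apply hs)
      (fun a b hab => by
        try dsimp only
        split_ifs
        · exact le_rfl
        · omega
        · exact hmono _ _ (by omega)
        · exact hmono _ _ (by omega))
    rw [patEval_cons] at hve
    have hTt := tail_eval hTdeg (fun a ha => hp a (by simp [ha])) (fun i => s (i + C.length + 1))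
      (fun i j hij => hmono _ _ (by omega))
    have eT : (fun i => if i + 1 = 0 then s 0 else s (i + 1 + C.length)) =
        fun i => s (i + C.length + 1) := by
      funext i
      rw [if_neg (by omega)]
      congr 1
      omega
    simp only [eT] at hve
    rw [patEval_cons, patEval_append, abel C, hBL]
    simp only [zero_mul, add_zero, one_mul, if_true] at hve ⊢
    set τ := patEval T (fun i => s (i + C.length + 1)) with hτ
    have hδ : ∀ i, s (i + 1 + 1) ≤ s (i + 1) := fun i => hmono _ _ (by omega)
    have hBn : ∀ i ∈ Finset.range C.length,
        0 ≤ psum C (i + 1) * ((s (i + 1) : ℤ) - s (i + 1 + 1)) := by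
      intro i hi
      have := hδ i
      exact mul_nonneg (psum_nonneg hCadm _ (Finset.mem_range.1 hi)) (by omega)
    have hW0 := Finset.sum_nonneg hBn
    set W := ∑ i ∈ Finset.range C.length,
      psum C (i + 1) * ((s (i + 1) : ℤ) - s (i + 1 + 1)) with hW
    have hτ0 : 0 ≤ τ := by
      rcases hTt with h | h
      · rw [hτ, h]; simp [patEval]
      · exact le_trans (by positivity) h
    obtain ⟨P, hP⟩ : ∃ P : ℕ, (P : ℤ) = s 0 + (W + τ) :=
      ⟨(s 0 + (W + τ)).toNat, by omega⟩
    rw [← hP]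
    refine ⟨P, ?_, rfl⟩
    have hPd : d ≤ P := by omega
    rcases Nat.even_or_odd P with hPe | hPo
    · obtain ⟨k, hk⟩ := hPe
      rw [show P = 2 * k by omega]
      exact mem_numDup_even (hES (hcond _ (by omega)))
    have big : d + 2 * condOf E ≤ P → P ∈ numDup S E d := by
      intro hb
      obtain ⟨k, hk⟩ := hPo
      obtain ⟨l, hl⟩ := hdo
      rw [show P = 2 * (k - l) + d by omega]
      exact mem_numDup_odd (hcond _ (by omega))
    by_cases hbig : d + 2 * condOf E ≤ P
    · exact big hbig
    have hτe : Even τ := by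
      rcases hTt with h | h
      · rw [hτ, h]; simp [patEval]
      · apply even_patEval
        intro i
        by_contra hc
        rw [Nat.not_even_iff_odd] at hc
        obtain ⟨e, he, h'⟩ := of_odd_mem (hs _) hc
        have h1 := hmono (0 + C.length + 1) (i + C.length + 1) (by omega)

        omega
    by_cases hA : ∀ i, i < C.length → s (i + 1 + 1) < s (i + 1) → Even (psum C (i + 1))
    · -- only even coefficients contribute
      have hsum : ∑ i ∈ Finset.range C.length,
          (psum C (i + 1) / 2) * ((s (i + 1) : ℤ) - s (i + 1 + 1)) ∈ EmE E := by
        apply Finset.sum_induction _ (fun z => z ∈ EmE E)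
        · intro a b; exact EmE_add
        · exact EmE_zero E
        · intro i hi
          rw [Finset.mem_range] at hi
          rcases (hδ i).lt_or_eq with h | h
          · have hev := hA i hi h
            have h1 := (hcd (i + 1 + 1) (by omega) (by omega)).1
            rw [hps i hi] at h1
            have h2 := EmE_mul (h1 (by rw [add_comm]; exact hev.add_one))
              (s (i + 1) - s (i + 1 + 1))
            rw [Nat.cast_sub h.le, add_sub_cancel_left] at h2
            exact h2
          · rw [h, sub_self, mul_zero]; exact EmE_zero E
      have hW2 : W = 2 * ∑ i ∈ Finset.range C.length,
          (psum C (i + 1) / 2) * ((s (i + 1) : ℤ) - s (i + 1 + 1)) := by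
        rw [hW, Finset.mul_sum]
        apply Finset.sum_congr rfl
        intro i hi
        rw [Finset.mem_range] at hi
        rcases (hδ i).lt_or_eq with h | h
        · rw [← mul_assoc, Int.two_mul_ediv_two_of_even (hA i hi h)]
        · rw [h]; simp
      obtain ⟨e, he, rfl⟩ := of_odd_mem hv (by
        rw [Nat.odd_iff] at hPo ⊢; omega)
      obtain ⟨f, hf, hfe⟩ := hsum e he
      rw [show P = 2 * f + d by omega]
      exact mem_numDup_odd hf
    · push Not at hA
      obtain ⟨j, hj, hjs, hjo⟩ := hA
      rw [Int.not_even_iff_odd] at hjo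
      have hWj : psum C (j + 1) ≤ W := by
        have h1 := Finset.single_le_sum hBn (Finset.mem_range.2 hj)
        refine le_trans ?_ h1
        have := psum_nonneg hCadm (j + 1) hj
        exact le_mul_of_one_le_right this (by omega)
      have h1 := (hcd (j + 1 + 1) (by omega) (by omega)).2
      rw [hps j hj] at h1
      have h2 := h1 (by rw [add_comm]; exact hjo.add_one)
      apply big
      obtain ⟨a, ha⟩ := hjo
      obtain ⟨b, hb⟩ := hPo
      obtain ⟨c, hc⟩ := hdo
      obtain ⟨t, ht⟩ := hτe
      by_cases hx : s 0 = 2 * sInf E + d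
      · omega
      · omega
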